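/- The key functional identity used in the proof of Proposition 2.1 (identity (we8)): Let β, γ ∈ ℤ² be such that β, γ and β + γ are all nonzero modulo N. Then for all z₁, z₂ ∈ ℂ with z₁ ∉ Γ_τ, z₂ ∉ Γ_τ and z₁ − z₂ ∉ Γ_τ, one has −φ_β(z₂) f_γ(z₁) + φ_γ(z₁) f_β(z₂) = −φ_{β+γ}(z₂) f_γ(z₁ − z₂) + φ_{β+γ}(z₁) f_β(z₂ − z₁). -/

import Mathlib

open scoped BigOperators
open Complex Matrix Finset

noncomputable section

/-- The lattice `Γ_τ = ℤ + τℤ`. -/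
def latticeGamma (τ : ℂ) : Set ℂ := {w | ∃ m n : ℤ, w = (m : ℂ) + (n : ℂ) * τ}

/-- The odd theta function `ϑ(z|τ)`. -/
def theta (τ z : ℂ) : ℂ :=
  Complex.exp (2 * (Real.pi : ℂ) * Complex.I * τ / 8) *
    ∑' m : ℤ, (-1 : ℂ) ^ m *
      Complex.exp (2 * (Real.pi : ℂ) * Complex.I * ((m : ℂ) * ((m : ℂ) + 1) * τ / 2 + (m : ℂ) * z))

/-- The first Eisenstein function `E₁(z) = ϑ'(z)/ϑ(z)`. -/
def E1 (τ z : ℂ) : ℂ := deriv (theta τ) z / theta τ z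

/-- The second Eisenstein function `E₂(z) = −E₁'(z)`. -/
def E2 (τ z : ℂ) : ℂ := -deriv (E1 τ) z

/-- The constant `η₁` determined by `E₁(z) = 1/z − 2η₁z + O(z³)` near `z = 0`. -/
def eta1 (τ : ℂ) : ℂ :=
  -(deriv (fun z : ℂ => if z = 0 then 0 else E1 τ z - 1 / z) 0) / 2

/-- The Weierstrass function `℘(z) = E₂(z) − 2η₁`. -/
def wp (τ z : ℂ) : ℂ := E2 τ z - 2 * eta1 τ

/-- The Kronecker function `φ(u,z) = ϑ(u+z)ϑ'(0)/(ϑ(u)ϑ(z))`. -/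
def kronPhi (τ u z : ℂ) : ℂ := theta τ (u + z) * deriv (theta τ) 0 / (theta τ u * theta τ z)

/-- `f(u,z) = ∂_u φ(u,z)`. -/
def kronF (τ u z : ℂ) : ℂ := deriv (fun u' => kronPhi τ u' z) u

/-- `e_N(z) = exp(2πiz/N)`. -/
def eN (N : ℕ) (z : ℂ) : ℂ := Complex.exp (2 * (Real.pi : ℂ) * Complex.I * z / N)

/-- The matrix `Q = diag(e_N(1),…,e_N(N−1),1)`. -/
def Qm (N : ℕ) : Matrix (Fin N) (Fin N) ℂ :=
  Matrix.diagonal fun i => eN N ((i : ℕ) + 1)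

/-- The cyclic shift matrix `Λ`. -/
def Lm (N : ℕ) : Matrix (Fin N) (Fin N) ℂ :=
  Matrix.of fun i j => if ((i : ℕ) + 1) % N = (j : ℕ) then 1 else 0

/-- The basis matrices `T_γ = e_N(γ₁γ₂/2) Q^{γ₁} Λ^{γ₂}` for `γ ∈ ℤ²`. -/
def Tm (N : ℕ) (γ : ℤ × ℤ) : Matrix (Fin N) (Fin N) ℂ :=
  eN N (((γ.1 * γ.2 : ℤ) : ℂ) / 2) • (Qm N ^ γ.1 * Lm N ^ γ.2)

/-- `ω_γ = (γ₁ + γ₂τ)/N`. -/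
def om (N : ℕ) (τ : ℂ) (γ : ℤ × ℤ) : ℂ := ((γ.1 : ℂ) + (γ.2 : ℂ) * τ) / N

/-- `φ_γ(z) = e_N(γ₂z) φ(ω_γ, z)`. -/
def phiG (N : ℕ) (τ : ℂ) (γ : ℤ × ℤ) (z : ℂ) : ℂ := eN N ((γ.2 : ℂ) * z) * kronPhi τ (om N τ γ) z

/-- `f_γ(z) = e_N(γ₂z) f(ω_γ, z)`. -/
def fG (N : ℕ) (τ : ℂ) (γ : ℤ × ℤ) (z : ℂ) : ℂ := eN N ((γ.2 : ℂ) * z) * kronF τ (om N τ γ) z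

/-- `F_γ(z) = φ_γ(z)E₁(z) − f_γ(z)`. -/
def FG (N : ℕ) (τ : ℂ) (γ : ℤ × ℤ) (z : ℂ) : ℂ := phiG N τ γ z * E1 τ z - fG N τ γ z

/-- A fixed set of representatives of the nonzero classes of `(ℤ/Nℤ)²`. -/
def GammaN' (N : ℕ) : Finset (ℤ × ℤ) :=
  ((Finset.range N ×ˢ Finset.range N).image fun p => ((p.1 : ℤ), (p.2 : ℤ))) \ {(0, 0)}


/-- General term of the odd theta series. -/
def tA (τ : ℂ) (m : ℤ) (z : ℂ) : ℂ :=
  cexp (Real.pi * I * m + Real.pi * I * ((m : ℂ) + 1/2) ^ 2 * τ + 2 * Real.pi * I * ((m : ℂ) + 1/2) * z)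

def tB (τ : ℂ) (m : ℤ) (z : ℂ) : ℂ :=
  cexp (2 * Real.pi * I * (m : ℂ) ^ 2 * τ + 4 * Real.pi * I * (m : ℂ) * z)

def tD (τ : ℂ) (m : ℤ) (z : ℂ) : ℂ :=
  cexp (2 * Real.pi * I * ((m : ℂ) + 1/2) ^ 2 * τ + 4 * Real.pi * I * ((m : ℂ) + 1/2) * z)

/-- The genuinely odd theta function. -/
def oT (τ z : ℂ) : ℂ := cexp (Real.pi * I * z) * theta τ z

def Th0 (τ z : ℂ) : ℂ := jacobiTheta₂ (2 * z) (2 * τ)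

def Th1 (τ z : ℂ) : ℂ := cexp (Real.pi * I * τ / 2 + 2 * Real.pi * I * z) *
  jacobiTheta₂ (2 * z + τ) (2 * τ)

lemma exp_pi_int (m : ℤ) : cexp (Real.pi * I * m) = (-1 : ℂ) ^ m := by
  rw [mul_comm, Complex.exp_int_mul, Complex.exp_pi_mul_I]

lemma theta_eq_jac (τ z : ℂ) :
    theta τ z = cexp (Real.pi * I * τ / 4) * jacobiTheta₂ (z + τ / 2 + 1 / 2) τ := by
  unfold theta jacobiTheta₂
  congr 1
  · congr 1; ring
  · refine tsum_congr fun m => ?_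
    rw [jacobiTheta₂_term, ← exp_pi_int, ← Complex.exp_add]
    congr 1; ring

lemma tA_eq (τ : ℂ) (m : ℤ) (z : ℂ) : tA τ m z =
    cexp (Real.pi * I * z) * cexp (Real.pi * I * τ / 4) *
      jacobiTheta₂_term m (z + τ / 2 + 1 / 2) τ := by
  rw [tA, jacobiTheta₂_term, ← Complex.exp_add, ← Complex.exp_add]
  congr 1; ring

lemma tB_eq (τ : ℂ) (m : ℤ) (z : ℂ) : tB τ m z = jacobiTheta₂_term m (2 * z) (2 * τ) := by
  rw [tB, jacobiTheta₂_term]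
  congr 1; ring

lemma tD_eq (τ : ℂ) (m : ℤ) (z : ℂ) : tD τ m z =
    cexp (Real.pi * I * τ / 2 + 2 * Real.pi * I * z) *
      jacobiTheta₂_term m (2 * z + τ) (2 * τ) := by
  rw [tD, jacobiTheta₂_term, ← Complex.exp_add]
  congr 1; ring

lemma im_two_mul_pos {τ : ℂ} (hτ : 0 < τ.im) : 0 < (2 * τ).im := by
  simpa using hτ

lemma hasSum_tA {τ : ℂ} (hτ : 0 < τ.im) (z : ℂ) : HasSum (fun m => tA τ m z) (oT τ z) := by
  simp_rw [tA_eq, oT, theta_eq_jac, ← mul_assoc]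
  exact (hasSum_jacobiTheta₂_term _ hτ).mul_left _

lemma hasSum_tB {τ : ℂ} (hτ : 0 < τ.im) (z : ℂ) : HasSum (fun m => tB τ m z) (Th0 τ z) := by
  simp_rw [tB_eq, Th0]
  exact hasSum_jacobiTheta₂_term _ (im_two_mul_pos hτ)

lemma hasSum_tD {τ : ℂ} (hτ : 0 < τ.im) (z : ℂ) : HasSum (fun m => tD τ m z) (Th1 τ z) := by
  simp_rw [tD_eq, Th1]
  exact (hasSum_jacobiTheta₂_term _ (im_two_mul_pos hτ)).mul_left _

lemma hasSum_mul_int {f g : ℤ → ℂ} {a b : ℂ} (hf : HasSum f a) (hg : HasSum g b) :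
    HasSum (fun p : ℤ × ℤ => f p.1 * g p.2) (a * b) :=
  hf.mul hg (summable_mul_of_summable_norm hf.summable.norm hg.summable.norm)

/-- Splitting of the index lattice according to parity. -/
def parEquiv : (ℤ × ℤ) ⊕ (ℤ × ℤ) ≃ ℤ × ℤ where
  toFun := Sum.elim (fun p => (p.1 + p.2, p.1 - p.2)) (fun p => (p.1 + p.2, p.1 - p.2 - 1))
  invFun p := if (p.1 + p.2) % 2 = 0 then Sum.inl ((p.1 + p.2) / 2, (p.1 - p.2) / 2)
    else Sum.inr ((p.1 + p.2 + 1) / 2, (p.1 - p.2 - 1) / 2)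
  left_inv := by
    rintro (⟨a, b⟩ | ⟨a, b⟩)
    · have h : (a + b + (a - b)) % 2 = 0 := by omega
      simp only [Sum.elim_inl, h, if_true]
      congr 2 <;> omega
    · have h : ¬ (a + b + (a - b - 1)) % 2 = 0 := by omega
      simp only [Sum.elim_inr, h, if_false]
      congr 2 <;> omega
  right_inv := by
    rintro ⟨a, b⟩
    by_cases h : (a + b) % 2 = 0
    · simp only [h, if_true, Sum.elim_inl, Prod.mk.injEq]
      constructor <;> omega
    · simp only [h, if_false, Sum.elim_inr, Prod.mk.injEq]
      constructor <;> omega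

lemma tA_mul_even (τ : ℂ) (a b : ℤ) (x y : ℂ) :
    tA τ (a + b) (x + y) * tA τ (a - b) (x - y) = tD τ a x * tB τ b y := by
  have h : cexp (Real.pi * I * ((2 * a : ℤ) : ℂ)) = 1 := by
    rw [exp_pi_int, _root_.zpow_mul]; norm_num
  rw [← mul_one (tD τ a x * tB τ b y), ← h]
  simp only [tA, tB, tD, ← Complex.exp_add]
  congr 1; push_cast; ring

lemma tA_mul_odd (τ : ℂ) (a b : ℤ) (x y : ℂ) :
    tA τ (a + b) (x + y) * tA τ (a - b - 1) (x - y) = -(tB τ a x * tD τ b y) := by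
  have h : cexp (Real.pi * I * ((2 * a - 1 : ℤ) : ℂ)) = -1 := by
    rw [exp_pi_int, zpow_sub₀ (by norm_num), _root_.zpow_mul]; norm_num
  rw [← mul_neg_one (tB τ a x * tD τ b y), ← h]
  simp only [tA, tB, tD, ← Complex.exp_add]
  congr 1; push_cast; ring

/-- Addition formula. -/
lemma oT_add {τ : ℂ} (hτ : 0 < τ.im) (x y : ℂ) :
    oT τ (x + y) * oT τ (x - y) = Th1 τ x * Th0 τ y - Th0 τ x * Th1 τ y := by
  have h1 := hasSum_mul_int (hasSum_tA hτ (x + y)) (hasSum_tA hτ (x - y))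
  have h2 := hasSum_mul_int (hasSum_tD hτ x) (hasSum_tB hτ y)
  have h3 := (hasSum_mul_int (hasSum_tB hτ x) (hasSum_tD hτ y)).neg
  rw [← parEquiv.hasSum_iff] at h1
  refine h1.unique ?_
  rw [sub_eq_add_neg (Th1 τ x * Th0 τ y)]
  refine HasSum.sum (M := ℂ) ?_ ?_
  · convert h2 using 2 with p
    exact tA_mul_even τ p.1 p.2 x y
  · have e : ((fun p : ℤ × ℤ => tA τ p.1 (x + y) * tA τ p.2 (x - y)) ∘ parEquiv) ∘ Sum.inr
        = fun p : ℤ × ℤ => -(tB τ p.1 x * tD τ p.2 y) := by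
      funext p
      exact tA_mul_odd τ p.1 p.2 x y
    rw [e]
    exact h3

lemma tA_refl (τ : ℂ) (m : ℤ) (z : ℂ) : tA τ (-1 - m) (-z) = - tA τ m z := by
  have h : cexp (Real.pi * I * ((-1 - 2 * m : ℤ) : ℂ)) = -1 := by
    rw [exp_pi_int, zpow_sub₀ (by norm_num), _root_.zpow_mul]; norm_num
  rw [← mul_neg_one (tA τ m z), ← h]
  simp only [tA, ← Complex.exp_add]
  congr 1; push_cast; ring

lemma oT_neg {τ : ℂ} (hτ : 0 < τ.im) (z : ℂ) : oT τ (-z) = - oT τ z := by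
  have h1 := (hasSum_tA hτ z).neg
  have h2 := hasSum_tA hτ (-z)
  rw [← (Equiv.subLeft (-1 : ℤ)).hasSum_iff] at h2
  refine h2.unique ?_
  have e : (fun m => tA τ m (-z)) ∘ (Equiv.subLeft (-1 : ℤ)) = fun m => -tA τ m z := by
    funext m
    exact tA_refl τ m z
  rw [e]; exact h1

/-- Weierstrass three-term identity. -/
lemma oT_three {τ : ℂ} (hτ : 0 < τ.im) (a b c d : ℂ) :
    oT τ (a + b) * oT τ (a - b) * (oT τ (c + d) * oT τ (c - d))
    - oT τ (a + c) * oT τ (a - c) * (oT τ (b + d) * oT τ (b - d))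
    + oT τ (a + d) * oT τ (a - d) * (oT τ (b + c) * oT τ (b - c)) = 0 := by
  simp only [oT_add hτ]
  ring

lemma kronPhi_eq (τ u z : ℂ) :
    kronPhi τ u z = oT τ (u + z) * deriv (theta τ) 0 / (oT τ u * oT τ z) := by
  have h : cexp (Real.pi * I * (u + z)) = cexp (Real.pi * I * u) * cexp (Real.pi * I * z) := by
    rw [← Complex.exp_add]; congr 1; ring
  have h1 := Complex.exp_ne_zero (Real.pi * I * u)
  have h2 := Complex.exp_ne_zero (Real.pi * I * z)
  rw [kronPhi, oT, oT, oT, h]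
  rw [show cexp (Real.pi * I * u) * cexp (Real.pi * I * z) * theta τ (u + z) * deriv (theta τ) 0
    = (cexp (Real.pi * I * u) * cexp (Real.pi * I * z)) * (theta τ (u + z) * deriv (theta τ) 0) by ring,
    show cexp (Real.pi * I * u) * theta τ u * (cexp (Real.pi * I * z) * theta τ z)
     = (cexp (Real.pi * I * u) * cexp (Real.pi * I * z)) * (theta τ u * theta τ z) by ring,
    mul_div_mul_left _ _ (mul_ne_zero h1 h2)]

/-- Fay identity. -/
lemma fay {τ : ℂ} (hτ : 0 < τ.im) (u₁ u₂ z₁ z₂ : ℂ) (hu1 : oT τ u₁ ≠ 0) (hu2 : oT τ u₂ ≠ 0)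
    (hu : oT τ (u₁ + u₂) ≠ 0) (hz1 : oT τ z₁ ≠ 0) (hz2 : oT τ z₂ ≠ 0)
    (hz : oT τ (z₁ - z₂) ≠ 0) :
    kronPhi τ u₁ z₁ * kronPhi τ u₂ z₂ = kronPhi τ u₁ (z₁ - z₂) * kronPhi τ (u₁ + u₂) z₂
      + kronPhi τ u₂ (z₂ - z₁) * kronPhi τ (u₁ + u₂) z₁ := by
  have key := oT_three hτ ((u₁ + u₂ + z₁ + z₂) / 2) ((u₁ - u₂ + z₁ - z₂) / 2)
    ((u₁ + u₂ + z₁ - z₂) / 2) ((u₁ + u₂ - z₁ + z₂) / 2)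
  rw [show (u₁ + u₂ + z₁ + z₂) / 2 + (u₁ - u₂ + z₁ - z₂) / 2 = u₁ + z₁ by ring,
    show (u₁ + u₂ + z₁ + z₂) / 2 - (u₁ - u₂ + z₁ - z₂) / 2 = u₂ + z₂ by ring,
    show (u₁ + u₂ + z₁ - z₂) / 2 + (u₁ + u₂ - z₁ + z₂) / 2 = u₁ + u₂ by ring,
    show (u₁ + u₂ + z₁ - z₂) / 2 - (u₁ + u₂ - z₁ + z₂) / 2 = z₁ - z₂ by ring,
    show (u₁ + u₂ + z₁ + z₂) / 2 + (u₁ + u₂ + z₁ - z₂) / 2 = u₁ + u₂ + z₁ by ring,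
    show (u₁ + u₂ + z₁ + z₂) / 2 - (u₁ + u₂ + z₁ - z₂) / 2 = z₂ by ring,
    show (u₁ - u₂ + z₁ - z₂) / 2 + (u₁ + u₂ - z₁ + z₂) / 2 = u₁ by ring,
    show (u₁ - u₂ + z₁ - z₂) / 2 - (u₁ + u₂ - z₁ + z₂) / 2 = -(u₂ + (z₂ - z₁)) by ring,
    show (u₁ + u₂ + z₁ + z₂) / 2 + (u₁ + u₂ - z₁ + z₂) / 2 = u₁ + u₂ + z₂ by ring,
    show (u₁ + u₂ + z₁ + z₂) / 2 - (u₁ + u₂ - z₁ + z₂) / 2 = z₁ by ring,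
    show (u₁ - u₂ + z₁ - z₂) / 2 + (u₁ + u₂ + z₁ - z₂) / 2 = u₁ + (z₁ - z₂) by ring,
    show (u₁ - u₂ + z₁ - z₂) / 2 - (u₁ + u₂ + z₁ - z₂) / 2 = -u₂ by ring,
    oT_neg hτ, oT_neg hτ] at key
  have e1 : oT τ (z₂ - z₁) = - oT τ (z₁ - z₂) := by rw [← oT_neg hτ]; congr 1; ring
  simp only [kronPhi_eq, e1]
  generalize oT τ (u₁ + z₁) = A1 at *
  generalize oT τ (u₂ + z₂) = A2 at *
  generalize oT τ (u₁ + (z₁ - z₂)) = A3 at *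
  generalize oT τ (u₂ + (z₂ - z₁)) = A4 at *
  generalize oT τ (u₁ + u₂ + z₁) = A5 at *
  generalize oT τ (u₁ + u₂ + z₂) = A6 at *
  generalize oT τ (u₁ + u₂) = A7 at *
  generalize oT τ (z₁ - z₂) = A8 at *
  generalize oT τ u₁ = B1 at *
  generalize oT τ u₂ = B2 at *
  generalize oT τ z₁ = B3 at *
  generalize oT τ z₂ = B4 at *
  field_simp
  linear_combination (deriv (theta τ) 0) ^ 2 * key

lemma oT_differentiable {τ : ℂ} (hτ : 0 < τ.im) : Differentiable ℂ (oT τ) := by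
  intro z
  unfold oT
  simp_rw [theta_eq_jac]
  have := differentiableAt_jacobiTheta₂_fst (z + τ / 2 + 1 / 2) hτ
  have h2 : DifferentiableAt ℂ (fun z => jacobiTheta₂ (z + τ / 2 + 1 / 2) τ) z :=
    this.comp (f := fun z => z + τ / 2 + 1 / 2) z (by fun_prop)
  fun_prop

lemma Th0_differentiable {τ : ℂ} (hτ : 0 < τ.im) : Differentiable ℂ (Th0 τ) := by
  intro z
  have := differentiableAt_jacobiTheta₂_fst (2 * z) (im_two_mul_pos hτ)
  exact this.comp (f := fun z => 2 * z) z (by fun_prop)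

lemma Th1_differentiable {τ : ℂ} (hτ : 0 < τ.im) : Differentiable ℂ (Th1 τ) := by
  intro z
  have := differentiableAt_jacobiTheta₂_fst (2 * z + τ) (im_two_mul_pos hτ)
  have h2 : DifferentiableAt ℂ (fun z => jacobiTheta₂ (2 * z + τ) (2 * τ)) z :=
    this.comp (f := fun z => 2 * z + τ) z (by fun_prop)
  unfold Th1
  fun_prop

lemma Th0_half (τ z : ℂ) : Th0 τ (z + 1 / 2) = Th0 τ z := by
  rw [Th0, Th0, ← jacobiTheta₂_add_left (2 * z)]
  congr 1; ring

lemma Th1_half (τ z : ℂ) : Th1 τ (z + 1 / 2) = - Th1 τ z := by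
  rw [Th1, Th1, ← jacobiTheta₂_add_left (2 * z + τ), ← neg_mul]
  congr 1
  · rw [← mul_neg_one, ← Complex.exp_pi_mul_I, ← Complex.exp_add]
    congr 1; ring
  · congr 1; ring

lemma Th0_tau (τ z : ℂ) : Th0 τ (z + τ / 2) =
    cexp (- Real.pi * I * τ / 2 - 2 * Real.pi * I * z) * Th1 τ z := by
  rw [Th0, Th1, ← mul_assoc, ← Complex.exp_add]
  rw [show 2 * (z + τ / 2) = 2 * z + τ by ring]
  ring_nf
  simp

lemma Th1_tau (τ z : ℂ) : Th1 τ (z + τ / 2) =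
    cexp (- Real.pi * I * τ / 2 - 2 * Real.pi * I * z) * Th0 τ z := by
  rw [Th0, Th1, show 2 * (z + τ / 2) + τ = 2 * z + 2 * τ by ring, jacobiTheta₂_add_left',
    ← mul_assoc, ← Complex.exp_add]
  congr 2; ring

lemma theta_integral {τ : ℂ} (hτ : 0 < τ.im) :
    ∫ x in (0:ℝ)..1, jacobiTheta₂ (x : ℂ) τ = 1 := by
  let f : ℤ → C(ℝ, ℂ) := fun n => ⟨fun x => jacobiTheta₂_term n (x : ℂ) τ, by
    unfold jacobiTheta₂_term; fun_prop⟩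
  have hn : ∀ n : ℤ, ∀ x : ℝ, ‖jacobiTheta₂_term n (x : ℂ) τ‖ = ‖jacobiTheta₂_term n 0 τ‖ := by
    intro n x
    rw [norm_jacobiTheta₂_term, norm_jacobiTheta₂_term]; simp
  have hs : Summable fun n => ‖(f n).restrict (⟨Set.uIcc (0:ℝ) 1, isCompact_uIcc⟩ :
      TopologicalSpace.Compacts ℝ)‖ := by
    refine Summable.of_nonneg_of_le (fun _ => norm_nonneg _) (fun n => ?_)
      ((summable_jacobiTheta₂_term_iff 0 τ).2 hτ).norm
    rw [ContinuousMap.norm_le _ (norm_nonneg _)]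
    intro x
    exact (hn n x).le
  have h := intervalIntegral.hasSum_intervalIntegral_of_summable_norm hs
  have h2 : HasSum (fun n : ℤ => ∫ x in (0:ℝ)..1, f n x) 1 := by
    have : (fun n : ℤ => ∫ x in (0:ℝ)..1, f n x) = fun n => if n = 0 then 1 else 0 := by
      funext n
      split_ifs with h0
      · subst h0
        simp [f, jacobiTheta₂_term]
      · have hc : (2 * Real.pi * I * n : ℂ) ≠ 0 := by
          simp [h0, Real.pi_ne_zero]
        have : ∀ x : ℝ, f n x = cexp (Real.pi * I * n ^ 2 * τ) * cexp (2 * Real.pi * I * n * x) := by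
          intro x
          change jacobiTheta₂_term n (x : ℂ) τ = _
          rw [jacobiTheta₂_term, ← Complex.exp_add]; congr 1; ring
        simp_rw [this]
        rw [intervalIntegral.integral_const_mul, integral_exp_mul_complex hc]
        have : cexp (2 * Real.pi * I * n * (1:ℝ)) = 1 := by
          rw [← Complex.exp_int_mul_two_pi_mul_I n]; congr 1; push_cast; ring
        rw [this]; simp
    rw [this]
    exact hasSum_ite_eq 0 1
  exact h.unique h2

lemma exists_oT_ne {τ : ℂ} (hτ : 0 < τ.im) : ∃ z, oT τ z ≠ 0 := by
  by_contra! h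
  have h0 : ∀ z, jacobiTheta₂ z τ = 0 := by
    intro z
    have := h (z - τ / 2 - 1 / 2)
    rw [oT, theta_eq_jac] at this
    rw [show z - τ / 2 - 1 / 2 + τ / 2 + 1 / 2 = z by ring] at this
    simpa using this
  have := theta_integral hτ
  simp [h0] at this

lemma Th_ne {τ : ℂ} (hτ : 0 < τ.im) (z : ℂ) : Th0 τ z ≠ 0 ∨ Th1 τ z ≠ 0 := by
  by_contra! h
  have h1 : ∀ y, oT τ (z + y) * oT τ (z - y) = 0 := by
    intro y; rw [oT_add hτ, h.1, h.2]; ring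
  have ha : AnalyticOnNhd ℂ (fun y => oT τ (z + y)) Set.univ := by
    rw [Complex.analyticOnNhd_univ_iff_differentiable]
    exact (oT_differentiable hτ).comp (by fun_prop)
  have hb : AnalyticOnNhd ℂ (fun y => oT τ (z - y)) Set.univ := by
    rw [Complex.analyticOnNhd_univ_iff_differentiable]
    exact (oT_differentiable hτ).comp (by fun_prop)
  obtain ⟨w, hw⟩ := exists_oT_ne hτ
  have := AnalyticOnNhd.eq_zero_or_eq_zero_of_mul_eq_zero ha hb (fun y _ => h1 y) isPreconnected_univ
  rcases this with h | h
  · apply hw; have := h (w - z) (Set.mem_univ _); simpa using this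
  · apply hw; have := h (z - w) (Set.mem_univ _); simpa using this

/-- Liouville for doubly periodic functions. -/
lemma const_of_periodic {τ : ℂ} (hτ : 0 < τ.im) {f : ℂ → ℂ} (hf : Differentiable ℂ f)
    (h1 : ∀ z, f (z + 1 / 2) = f z) (h2 : ∀ z, f (z + τ / 2) = f z) (z w : ℂ) : f z = f w := by
  have p1 : Function.Periodic f (1 / 2) := h1
  have p2 : Function.Periodic f (τ / 2) := h2
  apply hf.apply_eq_apply_of_bounded
  have hK : IsCompact ((fun p : ℝ × ℝ => f (p.1 * (1 / 2) + p.2 * (τ / 2))) ''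
      (Set.Icc 0 1 ×ˢ Set.Icc 0 1)) := by
    apply (isCompact_Icc.prod isCompact_Icc).image
    have := hf.continuous
    fun_prop
  refine hK.isBounded.subset ?_
  rintro _ ⟨z, rfl⟩
  let b : ℝ := 2 * z.im / τ.im
  let a : ℝ := 2 * (z.re - b / 2 * τ.re)
  have hz : z = a * (1 / 2) + b * (τ / 2) := by
    apply Complex.ext
    · simp [a]; ring
    · simp [b]; field_simp
  refine ⟨(Int.fract a, Int.fract b), ⟨⟨Int.fract_nonneg _, (Int.fract_lt_one _).le⟩,
    ⟨Int.fract_nonneg _, (Int.fract_lt_one _).le⟩⟩, ?_⟩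
  have e1 := (p1.int_mul ⌊a⌋) (((Int.fract a : ℝ) : ℂ) * (1 / 2) + ((Int.fract b : ℝ) : ℂ) * (τ / 2))
  have e2 := (p2.int_mul ⌊b⌋) (((Int.fract a : ℝ) : ℂ) * (1 / 2) + ((Int.fract b : ℝ) : ℂ) * (τ / 2)
    + ⌊a⌋ * (1 / 2))
  rw [e1] at e2
  simp only
  rw [← e2]
  congr 1
  have fa : (a : ℂ) = ⌊a⌋ + ((Int.fract a : ℝ) : ℂ) := by
    exact_mod_cast (Int.floor_add_fract a).symm
  have fb : (b : ℂ) = ⌊b⌋ + ((Int.fract b : ℝ) : ℂ) := by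
    exact_mod_cast (Int.floor_add_fract b).symm
  rw [hz, fa, fb]; simp; ring

lemma mem_lattice_of_oT_eq_zero {τ : ℂ} (hτ : 0 < τ.im) {u : ℂ} (hu : oT τ u = 0) :
    u ∈ latticeGamma τ := by
  have hpar : ∀ y, Th1 τ (y + u) * Th0 τ y - Th0 τ (y + u) * Th1 τ y = 0 := by
    intro y
    rw [← oT_add hτ, add_sub_cancel_left, hu, mul_zero]
  have hex : ∀ y, ∃ c, Th0 τ (y + u) = c * Th0 τ y ∧ Th1 τ (y + u) = c * Th1 τ y := by
    intro y
    rcases Th_ne hτ y with h | h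
    · refine ⟨Th0 τ (y + u) / Th0 τ y, by field_simp, ?_⟩
      field_simp; linear_combination hpar y
    · refine ⟨Th1 τ (y + u) / Th1 τ y, ?_, by field_simp⟩
      field_simp; linear_combination -hpar y
  choose c hc0 hc1 using hex
  have huniq : ∀ y d, Th0 τ (y + u) = d * Th0 τ y → Th1 τ (y + u) = d * Th1 τ y → c y = d := by
    intro y d h0 h1
    rcases Th_ne hτ y with h | h
    · exact mul_right_cancel₀ h ((hc0 y).symm.trans h0)
    · exact mul_right_cancel₀ h ((hc1 y).symm.trans h1)
  have hcne : ∀ y, c y ≠ 0 := by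
    intro y h
    rcases Th_ne hτ (y + u) with h' | h'
    · apply h'; rw [hc0, h, zero_mul]
    · apply h'; rw [hc1, h, zero_mul]
  have D0 := Th0_differentiable hτ
  have D1 := Th1_differentiable hτ
  have hcd : Differentiable ℂ c := by
    intro y
    rcases Th_ne hτ y with h | h
    · have hev : c =ᶠ[nhds y] fun y => Th0 τ (y + u) / Th0 τ y := by
        filter_upwards [D0.continuous.continuousAt.eventually_ne h] with w hw
        rw [hc0 w]; field_simp
      refine DifferentiableAt.congr_of_eventuallyEq ?_ hev
      have : DifferentiableAt ℂ (fun y => Th0 τ (y + u)) y := (D0 _).comp (f := fun y => y + u) y (by fun_prop)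
      exact this.div (D0 y) h
    · have hev : c =ᶠ[nhds y] fun y => Th1 τ (y + u) / Th1 τ y := by
        filter_upwards [D1.continuous.continuousAt.eventually_ne h] with w hw
        rw [hc1 w]; field_simp
      refine DifferentiableAt.congr_of_eventuallyEq ?_ hev
      have : DifferentiableAt ℂ (fun y => Th1 τ (y + u)) y := (D1 _).comp (f := fun y => y + u) y (by fun_prop)
      exact this.div (D1 y) h
  have hch : ∀ y, c (y + 1 / 2) = c y := by
    intro y
    apply huniq
    · rw [add_right_comm, Th0_half, Th0_half, hc0]
    · rw [add_right_comm, Th1_half, Th1_half, hc1]; ring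
  have hct : ∀ y, c (y + τ / 2) = cexp (- (2 * Real.pi * I * u)) * c y := by
    intro y
    have e : cexp (- Real.pi * I * τ / 2 - 2 * Real.pi * I * (y + u))
        = cexp (- (2 * Real.pi * I * u)) * cexp (- Real.pi * I * τ / 2 - 2 * Real.pi * I * y) := by
      rw [← Complex.exp_add]; congr 1; ring
    apply huniq
    · rw [add_right_comm, Th0_tau, Th0_tau, hc1, e]; ring
    · rw [add_right_comm, Th1_tau, Th1_tau, hc0, e]; ring
  have hc'd : Differentiable ℂ (deriv c) := by
    have := ((Complex.analyticOnNhd_univ_iff_differentiable.2 hcd).deriv)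
    exact Complex.analyticOnNhd_univ_iff_differentiable.1 this
  have hd1 : ∀ y, deriv c (y + 1 / 2) = deriv c y := by
    intro y
    rw [← deriv_comp_add_const]
    congr 1; funext y; exact hch y
  have hd2 : ∀ y, deriv c (y + τ / 2) = cexp (- (2 * Real.pi * I * u)) * deriv c y := by
    intro y
    rw [← deriv_comp_add_const, ← deriv_const_mul _ (hcd y)]
    congr 1; funext y; exact hct y
  have hconst := const_of_periodic hτ (f := fun y => deriv c y / c y) (hc'd.div hcd hcne)
    (fun y => by simp only [hd1, hch])
    (fun y => by
      simp only [hd2, hct]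
      exact mul_div_mul_left _ _ (Complex.exp_ne_zero _))
  obtain ⟨κ, hκ⟩ : ∃ κ, ∀ y, deriv c y = κ * c y := ⟨deriv c 0 / c 0, fun y => by
    rw [hconst 0 y]; exact (div_mul_cancel₀ _ (hcne y)).symm⟩
  have hexp : ∀ y, c y = c 0 * cexp (κ * y) := by
    intro y
    have hg : ∀ y, HasDerivAt (fun y => c y * cexp (-(κ * y))) 0 y := by
      intro y
      have h1 := (hcd y).hasDerivAt
      have h2 : HasDerivAt (fun y => cexp (-(κ * y))) (cexp (-(κ * y)) * (-(κ * 1))) y :=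
        (((hasDerivAt_id y).const_mul κ).neg).cexp
      refine (h1.mul h2).congr_deriv ?_
      rw [hκ]; ring
    have := is_const_of_deriv_eq_zero (fun y => (hg y).differentiableAt) (fun y => (hg y).deriv) y 0
    simp only [mul_zero, neg_zero, Complex.exp_zero, mul_one] at this
    rw [← this, mul_assoc, ← Complex.exp_add]; simp
  have k1 : cexp (κ * (1 / 2)) = 1 := by
    have := hch 0
    rw [hexp (0 + 1 / 2), zero_add] at this
    exact mul_left_cancel₀ (hcne 0) (by rw [this, mul_one])
  have k2 : cexp (κ * (τ / 2)) = cexp (- (2 * Real.pi * I * u)) := by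
    have := hct 0
    rw [hexp (0 + τ / 2), zero_add] at this
    exact mul_left_cancel₀ (hcne 0) (by rw [this, mul_comm])
  obtain ⟨k, hk⟩ := Complex.exp_eq_one_iff.1 k1
  obtain ⟨n, hn⟩ := Complex.exp_eq_exp_iff_exists_int.1 k2
  refine ⟨n, -k, ?_⟩
  have hpi : (2 * Real.pi * I : ℂ) ≠ 0 := Complex.two_pi_I_ne_zero
  apply mul_left_cancel₀ hpi
  push_cast
  linear_combination hn - τ * hk

lemma oT_ne {τ : ℂ} (hτ : 0 < τ.im) {u : ℂ} (hu : u ∉ latticeGamma τ) : oT τ u ≠ 0 :=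
  fun h => hu (mem_lattice_of_oT_eq_zero hτ h)

lemma om_not_mem {τ : ℂ} (hτ : 0 < τ.im) {N : ℕ} (hN : 2 ≤ N) (γ : ℤ × ℤ)
    (hγ : ¬((γ.1 : ZMod N) = 0 ∧ (γ.2 : ZMod N) = 0)) : om N τ γ ∉ latticeGamma τ := by
  rintro ⟨m, n, h⟩
  have hN0 : (N : ℂ) ≠ 0 := by exact_mod_cast (by omega : N ≠ 0)
  rw [om, div_eq_iff hN0] at h
  have him := congrArg Complex.im h
  have hre := congrArg Complex.re h
  simp at him hre
  have h2 : (γ.2 : ℝ) = n * N := by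
    apply mul_right_cancel₀ hτ.ne'
    linear_combination him
  have h1 : (γ.1 : ℝ) = m * N := by
    rw [h2] at hre; linear_combination hre
  have h2' : γ.2 = n * N := by exact_mod_cast h2
  have h1' : γ.1 = m * N := by exact_mod_cast h1
  apply hγ
  rw [h1', h2']; simp

lemma kronPhi_hasDerivAt {τ : ℂ} (hτ : 0 < τ.im) {u z : ℂ} (hu : oT τ u ≠ 0) (hz : oT τ z ≠ 0) :
    HasDerivAt (fun u' => kronPhi τ u' z) (kronF τ u z) u := by
  apply DifferentiableAt.hasDerivAt
  simp_rw [kronPhi_eq]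
  have D := oT_differentiable hτ
  have h1 : DifferentiableAt ℂ (fun u => oT τ (u + z)) u :=
    (D _).comp (f := fun u => u + z) u (by fun_prop)
  exact (h1.mul_const _).div ((D u).mul_const _) (mul_ne_zero hu hz)

lemma fay_deriv {τ : ℂ} (hτ : 0 < τ.im) (u₁ u₂ z₁ z₂ : ℂ) (hu1 : oT τ u₁ ≠ 0) (hu2 : oT τ u₂ ≠ 0)
    (hu : oT τ (u₁ + u₂) ≠ 0) (hz1 : oT τ z₁ ≠ 0) (hz2 : oT τ z₂ ≠ 0)
    (hz : oT τ (z₁ - z₂) ≠ 0) :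
    -kronPhi τ u₂ z₂ * kronF τ u₁ z₁ + kronPhi τ u₁ z₁ * kronF τ u₂ z₂
      = -kronPhi τ (u₁ + u₂) z₂ * kronF τ u₁ (z₁ - z₂)
        + kronPhi τ (u₁ + u₂) z₁ * kronF τ u₂ (z₂ - z₁) := by
  have hz' : oT τ (z₂ - z₁) ≠ 0 := by
    rw [← neg_sub, oT_neg hτ]; exact neg_ne_zero.2 hz
  have C := (oT_differentiable hτ).continuous
  have d1 : ∀ z, oT τ z ≠ 0 →
      HasDerivAt (fun t => kronPhi τ (u₁ - t) z) (-kronF τ u₁ z) 0 := by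
    intro z hz
    have h := kronPhi_hasDerivAt hτ (u := u₁ - 0) (by rwa [sub_zero]) hz
    have := h.comp (0 : ℂ) ((hasDerivAt_id (0 : ℂ)).const_sub u₁)
    simpa [Function.comp_def] using! this
  have d2 : ∀ z, oT τ z ≠ 0 →
      HasDerivAt (fun t => kronPhi τ (u₂ + t) z) (kronF τ u₂ z) 0 := by
    intro z hz
    have h := kronPhi_hasDerivAt hτ (u := u₂ + 0) (by rwa [add_zero]) hz
    have := h.comp (0 : ℂ) ((hasDerivAt_id (0 : ℂ)).const_add u₂)
    simpa [Function.comp_def] using! this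
  have L := (d1 z₁ hz1).mul (d2 z₂ hz2)
  have R := ((d1 _ hz).mul_const (kronPhi τ (u₁ + u₂) z₂)).add
    ((d2 _ hz').mul_const (kronPhi τ (u₁ + u₂) z₁))
  have ev1 : ∀ᶠ t in nhds (0 : ℂ), oT τ (u₁ - t) ≠ 0 :=
    ContinuousAt.eventually_ne (g := fun t => oT τ (u₁ - t)) (by fun_prop) (by simpa using hu1)
  have ev2 : ∀ᶠ t in nhds (0 : ℂ), oT τ (u₂ + t) ≠ 0 :=
    ContinuousAt.eventually_ne (g := fun t => oT τ (u₂ + t)) (by fun_prop) (by simpa using hu2)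
  have R' := R.congr_of_eventuallyEq (f₁ := fun t => kronPhi τ (u₁ - t) z₁ * kronPhi τ (u₂ + t) z₂) (by
    filter_upwards [ev1, ev2] with t h1 h2
    have e : u₁ - t + (u₂ + t) = u₁ + u₂ := by ring
    have := fay hτ (u₁ - t) (u₂ + t) z₁ z₂ h1 h2 (by rwa [e]) hz1 hz2 hz
    rw [e] at this
    exact this)
  have := L.unique R'
  simp only [sub_zero, add_zero] at this
  linear_combination this

/-- **Identity (we8)**: for `β, γ, β+γ` nonzero mod `N` and admissible `z₁, z₂`,
`−φ_β(z₂)f_γ(z₁) + φ_γ(z₁)f_β(z₂) = −φ_{β+γ}(z₂)f_γ(z₁−z₂) + φ_{β+γ}(z₁)f_β(z₂−z₁)`. -/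
theorem key_identity_we8
    (τ : ℂ) (hτ : 0 < τ.im) (N : ℕ) (hN : 2 ≤ N)
    (β γ : ℤ × ℤ)
    (hβ : ¬((β.1 : ZMod N) = 0 ∧ (β.2 : ZMod N) = 0))
    (hγ : ¬((γ.1 : ZMod N) = 0 ∧ (γ.2 : ZMod N) = 0))
    (hβγ : ¬(((β.1 + γ.1 : ℤ) : ZMod N) = 0 ∧ ((β.2 + γ.2 : ℤ) : ZMod N) = 0))
    (z₁ z₂ : ℂ)
    (h1 : z₁ ∉ latticeGamma τ) (h2 : z₂ ∉ latticeGamma τ)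
    (h12 : z₁ - z₂ ∉ latticeGamma τ) :
    -phiG N τ β z₂ * fG N τ γ z₁ + phiG N τ γ z₁ * fG N τ β z₂
      = -phiG N τ (β + γ) z₂ * fG N τ γ (z₁ - z₂)
          + phiG N τ (β + γ) z₁ * fG N τ β (z₂ - z₁) := by
  have hb := oT_ne hτ (om_not_mem hτ hN β hβ)
  have hg := oT_ne hτ (om_not_mem hτ hN γ hγ)
  have hbg := oT_ne hτ (om_not_mem hτ hN (β + γ) hβγ)
  have eo : om N τ (β + γ) = om N τ γ + om N τ β := by
    simp only [om, Prod.fst_add, Prod.snd_add]; push_cast; ring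
  have key := fay_deriv hτ (om N τ γ) (om N τ β) z₁ z₂ hg hb (eo ▸ hbg) (oT_ne hτ h1) (oT_ne hτ h2)
    (oT_ne hτ h12)
  rw [← eo] at key
  have E1 : eN N (((β + γ).2 : ℂ) * z₂) * eN N ((γ.2 : ℂ) * (z₁ - z₂))
      = eN N ((β.2 : ℂ) * z₂) * eN N ((γ.2 : ℂ) * z₁) := by
    simp only [eN, ← Complex.exp_add, Prod.snd_add]; congr 1; push_cast; ring
  have E2 : eN N (((β + γ).2 : ℂ) * z₁) * eN N ((β.2 : ℂ) * (z₂ - z₁))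
      = eN N ((β.2 : ℂ) * z₂) * eN N ((γ.2 : ℂ) * z₁) := by
    simp only [eN, ← Complex.exp_add, Prod.snd_add]; congr 1; push_cast; ring
  simp only [phiG, fG]
  linear_combination eN N ((β.2 : ℂ) * z₂) * eN N ((γ.2 : ℂ) * z₁) * key
    + kronPhi τ (om N τ (β + γ)) z₂ * kronF τ (om N τ γ) (z₁ - z₂) * E1
    - kronPhi τ (om N τ (β + γ)) z₁ * kronF τ (om N τ β) (z₂ - z₁) * E2

end
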